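/- arXiv:1802.03630 — 2 statements merged into one kernel-verified Lean document; each statement's English description precedes it below -/
import Mathlib

section
/- Assume τ := sup_{z∈B_Δ} |(log g′)′(z)| < 1/9, and let n be such that Mₙ < Δ/2. Let x₀ ∈ ℝ, 0 < y₀ ≤ 1, and z₀ = x₀ + i·mₙ(x₀)·y₀. Then for every 0 ≤ j ≤ q_{n+1} the iterate g^j(z₀) is defined and lies in B_Δ, the complex number y_j defined by g^j(z₀) = g^j(x₀) + i·mₙ(g^j(x₀))·y_j satisfies Re y_j > 0, and |y_j − y₀| ≤ (3/4)·y₀. -/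
open Filter Topology

/-- Gauss-map orbit of `α`: `α₀ = α`, `αₙ₊₁ = 1 / fract(αₙ)`. -/
noncomputable def cfGauss (α : ℝ) : ℕ → ℝ
  | 0 => α
  | n + 1 => (Int.fract (cfGauss α n))⁻¹

/-- Partial quotients `aₙ` of the continued fraction of `α`. -/
noncomputable def cfA (α : ℝ) (n : ℕ) : ℤ := ⌊cfGauss α n⌋

/-- Numerators `pₙ` of the convergents of `α`. -/
noncomputable def cfP (α : ℝ) : ℕ → ℤ
  | 0 => cfA α 0
  | 1 => cfA α 1 * cfA α 0 + 1
  | n + 2 => cfA α (n + 2) * cfP α (n + 1) + cfP α n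

/-- Denominators `qₙ` of the convergents of `α` (as natural numbers). -/
noncomputable def cfQ (α : ℝ) : ℕ → ℕ
  | 0 => 1
  | 1 => (cfA α 1).toNat
  | n + 2 => (cfA α (n + 2)).toNat * cfQ α (n + 1) + cfQ α n

/-- `gₙ(x) = g^{qₙ}(x) − pₙ`. -/
noncomputable def cfIter (g : ℝ → ℝ) (α : ℝ) (n : ℕ) (x : ℝ) : ℝ :=
  g^[cfQ α n] x - cfP α n

lemma dy_gauss_irr {α : ℝ} (hα : Irrational α) (n : ℕ) : Irrational (cfGauss α n) := by
  induction n with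
  | zero => exact hα
  | succ n ih =>
    have h : Irrational (Int.fract (cfGauss α n)) := by
      unfold Int.fract
      exact ih.sub_intCast _
    exact h.inv

lemma dy_fract_pos {α : ℝ} (hα : Irrational α) (n : ℕ) : 0 < Int.fract (cfGauss α n) := by
  rcases (Int.fract_nonneg (cfGauss α n)).lt_or_eq with h | h
  · exact h
  · exfalso
    have h1 := Int.self_sub_fract (cfGauss α n)
    rw [← h, sub_zero] at h1
    exact (dy_gauss_irr hα n).ne_int _ h1

lemma dy_A_pos {α : ℝ} (hα : Irrational α) (n : ℕ) : 1 ≤ cfA α (n + 1) := by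
  unfold cfA
  rw [Int.le_floor]
  simp only [cfGauss, Int.cast_one]
  exact (one_le_inv₀ (dy_fract_pos hα n)).2 (Int.fract_lt_one _).le

lemma dy_A_cast {α : ℝ} (hα : Irrational α) (n : ℕ) :
    ((cfA α (n + 1)).toNat : ℤ) = cfA α (n + 1) :=
  Int.toNat_of_nonneg (by have := dy_A_pos hα n; omega)

lemma dy_Q_pos {α : ℝ} (hα : Irrational α) (n : ℕ) : 0 < cfQ α n := by
  induction n using Nat.strong_induction_on with
  | _ n ih =>
    match n with
    | 0 => simp [cfQ]
    | 1 =>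
      have := dy_A_pos hα 0
      simp only [cfQ]
      simp only [zero_add] at this
      omega
    | n + 2 =>
      have := ih n (by omega)
      simp only [cfQ]
      omega

lemma dy_Q_succ {α : ℝ} (hα : Irrational α) (n : ℕ) :
    (cfQ α (n + 2) : ℤ) = cfA α (n + 2) * cfQ α (n + 1) + cfQ α n := by
  simp only [cfQ]
  push_cast [dy_A_cast hα (n + 1)]
  rfl

lemma dy_Q_one {α : ℝ} (hα : Irrational α) : (cfQ α 1 : ℤ) = cfA α 1 := by
  simp only [cfQ]
  exact dy_A_cast hα 0

lemma dy_det {α : ℝ} (hα : Irrational α) (n : ℕ) :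
    cfP α (n + 1) * cfQ α n - cfP α n * cfQ α (n + 1) = (-1) ^ n := by
  induction n with
  | zero =>
    simp only [zero_add]
    rw [dy_Q_one hα]
    simp only [cfP, cfQ]
    push_cast
    ring
  | succ n ih =>
    rw [dy_Q_succ hα]
    simp only [cfP]
    rw [pow_succ, ← ih]
    ring

/-- Signed error of the convergents. -/
noncomputable def dyD (α : ℝ) (n : ℕ) : ℝ := cfQ α n * α - cfP α n

lemma dy_D_succ {α : ℝ} (hα : Irrational α) (n : ℕ) :
    dyD α (n + 1) = - Int.fract (cfGauss α (n + 1)) * dyD α n := by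
  induction n with
  | zero =>
    have h1 : ((cfQ α 1 : ℕ) : ℝ) = (cfA α 1 : ℝ) := by exact_mod_cast dy_Q_one hα
    have h0 := dy_fract_pos hα 0
    have h2 : cfGauss α 1 = (Int.fract (cfGauss α 0))⁻¹ := rfl
    have h3 : Int.fract (cfGauss α 1) = cfGauss α 1 - cfA α 1 := rfl
    have h4 : Int.fract (cfGauss α 0) = α - cfA α 0 := rfl
    simp only [dyD, zero_add, h1]
    rw [h3, h2]
    simp only [cfQ, cfP]
    push_cast
    rw [h4] at h0 ⊢
    field_simp
    ring
  | succ n ih =>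
    have h1 : ((cfQ α (n + 2) : ℕ) : ℝ) = (cfA α (n + 2) : ℝ) * cfQ α (n + 1) + cfQ α n := by
      exact_mod_cast dy_Q_succ hα n
    have h0 := dy_fract_pos hα (n + 1)
    have h2 : cfGauss α (n + 2) = (Int.fract (cfGauss α (n + 1)))⁻¹ := rfl
    have h3 : Int.fract (cfGauss α (n + 2)) = cfGauss α (n + 2) - cfA α (n + 2) := rfl
    have h5 : dyD α (n + 2) = cfA α (n + 2) * dyD α (n + 1) + dyD α n := by
      simp only [dyD, h1, cfP]
      push_cast
      ring
    have h6 : dyD α n = - cfGauss α (n + 2) * dyD α (n + 1) := by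
      rw [ih, h2]
      field_simp
    show dyD α (n + 2) = - Int.fract (cfGauss α (n + 2)) * dyD α (n + 1)
    rw [h5, h3, h6]
    ring

lemma dy_D_ne {α : ℝ} (hα : Irrational α) (n : ℕ) : dyD α n ≠ 0 := by
  induction n with
  | zero =>
    have h0 := dy_fract_pos hα 0
    have h4 : Int.fract (cfGauss α 0) = α - cfA α 0 := rfl
    simp only [dyD, cfQ, cfP]
    push_cast
    rw [one_mul, ← h4]
    exact h0.ne'
  | succ n ih =>
    rw [dy_D_succ hα]
    exact mul_ne_zero (neg_ne_zero.2 (dy_fract_pos hα _).ne') ih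

lemma dy_D_abs_lt {α : ℝ} (hα : Irrational α) (n : ℕ) : |dyD α n| < 1 := by
  induction n with
  | zero =>
    have h0 := dy_fract_pos hα 0
    have h4 : Int.fract (cfGauss α 0) = α - cfA α 0 := rfl
    simp only [dyD, cfQ, cfP]
    push_cast
    rw [one_mul, ← h4, abs_of_pos h0]
    exact Int.fract_lt_one _
  | succ n ih =>
    rw [dy_D_succ hα, abs_mul, abs_neg, abs_of_pos (dy_fract_pos hα _)]
    nlinarith [Int.fract_lt_one (cfGauss α (n + 1)), abs_nonneg (dyD α n),
      dy_fract_pos hα (n + 1)]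

/-- Best approximation property. -/
lemma dy_best {α : ℝ} (hα : Irrational α) (n : ℕ) (k p : ℤ) (hk : 0 < k)
    (hk' : k < cfQ α (n + 1)) : |dyD α n| ≤ |k * α - p| := by
  have hdet := dy_det hα n
  have hq : (0 : ℤ) < cfQ α n := by exact_mod_cast dy_Q_pos hα n
  have hq' : (0 : ℤ) < cfQ α (n + 1) := by exact_mod_cast dy_Q_pos hα (n + 1)
  have hD := dy_D_succ hα n
  have hf := dy_fract_pos hα (n + 1)
  set e : ℤ := (-1) ^ n with he
  have hee : e * e = 1 := by rw [he, ← mul_pow]; norm_num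
  obtain ⟨u, v, hku, hpu⟩ : ∃ u v : ℤ, k = u * cfQ α n + v * cfQ α (n + 1) ∧
      p = u * cfP α n + v * cfP α (n + 1) := by
    refine ⟨e * (k * cfP α (n + 1) - p * cfQ α (n + 1)), e * (p * cfQ α n - k * cfP α n), ?_, ?_⟩
    · linear_combination (-k) * hee - k * e * hdet
    · linear_combination (-p) * hee - p * e * hdet
  have hval : (k : ℝ) * α - p = u * dyD α n + v * dyD α (n + 1) := by
    rw [hku, hpu]
    simp only [dyD]
    push_cast
    ring
  set F := Int.fract (cfGauss α (n + 1))
  have hval' : (k : ℝ) * α - p = (u - v * F) * dyD α n := by rw [hval, hD]; ring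
  rw [hval', abs_mul]
  have key : (1 : ℝ) ≤ |(u : ℝ) - v * F| := by
    rcases lt_trichotomy u 0 with hu | hu | hu
    · have hv : 0 ≤ v := by
        by_contra hv
        push Not at hv
        nlinarith
      have hu' : (u : ℝ) ≤ -1 := by exact_mod_cast (by omega : u ≤ -1)
      have hv' : (0 : ℝ) ≤ v := by exact_mod_cast hv
      rw [le_abs]; right
      nlinarith [mul_nonneg hv' hf.le]
    · exfalso
      subst hu
      rw [zero_mul, zero_add] at hku
      rcases le_or_gt v 0 with hv | hv
      · nlinarith
      · nlinarith
    · have hv : v ≤ 0 := by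
        by_contra hv
        push Not at hv
        nlinarith
      have hu' : (1 : ℝ) ≤ u := by exact_mod_cast (by omega : 1 ≤ u)
      have hv' : (v : ℝ) ≤ 0 := by exact_mod_cast hv
      rw [le_abs]; left
      nlinarith [mul_nonneg (neg_nonneg.2 hv') hf.le]
  nlinarith [abs_nonneg (dyD α n)]

lemma dy_best' {α : ℝ} (hα : Irrational α) (n : ℕ) (j k : ℕ) (p : ℤ) (hjk : j ≠ k)
    (hj : j < cfQ α (n + 1)) (hk : k < cfQ α (n + 1)) :
    |dyD α n| ≤ |((j : ℝ) - k) * α - p| := by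
  rcases lt_or_gt_of_ne hjk with h | h
  · have := dy_best hα n ((k : ℤ) - j) (-p) (by omega) (by omega)
    rw [← abs_neg (((j : ℝ) - k) * α - p)]
    push_cast at this
    convert this using 2
    ring
  · have := dy_best hα n ((j : ℤ) - k) p (by omega) (by omega)
    push_cast at this
    exact this

lemma dy_order (f : CircleDeg1Lift) (hα : Irrational f.translationNumber) (x : ℝ) (a b : ℕ)
    (s t : ℤ) (h : a * f.translationNumber + s ≤ b * f.translationNumber + t) :
    f^[a] x + s ≤ f^[b] x + t := by
  set α := f.translationNumber with hαd
  rcases lt_trichotomy a b with hab | hab | hab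
  · obtain ⟨d, rfl⟩ := Nat.exists_eq_add_of_lt hab
    have h1 : ((s - t : ℤ) : ℝ) ≤ (f ^ (d + 1)).translationNumber := by
      rw [f.translationNumber_pow]
      push_cast at h ⊢
      rw [← hαd]
      linarith
    have h2 : ((s - t : ℤ) : ℝ) ≠ (f ^ (d + 1)).translationNumber := by
      rw [f.translationNumber_pow, ← hαd]
      exact ((hα.natCast_mul (by omega)).ne_int _).symm
    have h3 := (f ^ (d + 1)).lt_map_of_int_lt_translationNumber (lt_of_le_of_ne h1 h2) (f^[a] x)
    rw [CircleDeg1Lift.coe_pow, ← Function.iterate_add_apply] at h3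
    rw [show a + d + 1 = d + 1 + a by omega]
    push_cast at h3
    linarith
  · subst hab
    linarith
  · obtain ⟨d, rfl⟩ := Nat.exists_eq_add_of_lt hab
    have h1 : (f ^ (d + 1)).translationNumber ≤ ((t - s : ℤ) : ℝ) := by
      rw [f.translationNumber_pow]
      push_cast at h ⊢
      rw [← hαd]
      linarith
    have h2 : (f ^ (d + 1)).translationNumber ≠ ((t - s : ℤ) : ℝ) := by
      rw [f.translationNumber_pow, ← hαd]
      exact ((hα.natCast_mul (by omega)).ne_int _)
    have h3 := (f ^ (d + 1)).map_lt_of_translationNumber_lt_int (lt_of_le_of_ne h1 h2) (f^[b] x)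
    rw [CircleDeg1Lift.coe_pow, ← Function.iterate_add_apply] at h3
    rw [show b + d + 1 = d + 1 + b by omega]
    push_cast at h3
    linarith

open MeasureTheory in
lemma dy_sum_le (N : ℕ) (a b : ℕ → ℝ) (c : ℝ) (hab : ∀ j < N, a j ≤ b j)
    (hc : ∀ j < N, c ≤ a j) (hc' : ∀ j < N, b j ≤ c + 1)
    (hd : ∀ j < N, ∀ k < N, j ≠ k → b j ≤ a k ∨ b k ≤ a j) :
    ∑ j ∈ Finset.range N, (b j - a j) ≤ 1 := by
  have h1 : volume (⋃ j ∈ Finset.range N, Set.Ioo (a j) (b j)) =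
      ∑ j ∈ Finset.range N, volume (Set.Ioo (a j) (b j)) := by
    apply measure_biUnion_finset
    · intro j hj k hk hjk
      simp only [Finset.coe_range, Set.mem_Iio] at hj hk
      simp only [Function.onFun]
      rw [Set.disjoint_left]
      rintro y ⟨h1, h2⟩ ⟨h3, h4⟩
      rcases hd j hj k hk hjk with h | h <;> linarith
    · intro j _
      exact measurableSet_Ioo
  have h2 : volume (⋃ j ∈ Finset.range N, Set.Ioo (a j) (b j)) ≤ volume (Set.Icc c (c + 1)) := by
    apply measure_mono
    intro y hy
    simp only [Set.mem_iUnion, Finset.mem_range, Set.mem_Ioo] at hy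
    obtain ⟨j, hj, h3, h4⟩ := hy
    exact ⟨by linarith [hc j hj], by linarith [hc' j hj]⟩
  rw [h1] at h2
  simp only [Real.volume_Ioo, Real.volume_Icc] at h2
  rw [← ENNReal.ofReal_sum_of_nonneg] at h2
  · have := (ENNReal.ofReal_le_ofReal_iff (by linarith)).1 h2
    linarith
  · intro j hj
    linarith [hab j (Finset.mem_range.1 hj)]

lemma dy_sum (f : CircleDeg1Lift) (hα : Irrational f.translationNumber) (x : ℝ) (n : ℕ) :
    ∑ j ∈ Finset.range (cfQ f.translationNumber (n + 1)),
      |cfIter f f.translationNumber n (f^[j] x) - f^[j] x| ≤ 1 := by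
  have hord := dy_order f hα x
  have hbest := dy_best' hα n
  have hne := dy_D_ne hα n
  set α := f.translationNumber with hαd
  have hit : ∀ j, cfIter f α n (f^[j] x) = f^[j + cfQ α n] x + ((-cfP α n : ℤ) : ℝ) := by
    intro j
    unfold cfIter
    rw [← Function.iterate_add_apply, add_comm j]
    push_cast
    ring
  have hDdef : dyD α n = cfQ α n * α - cfP α n := rfl
  rcases lt_or_gt_of_ne hne with hneg | hpos
  · have hb : ∀ j, cfIter f α n (f^[j] x) ≤ f^[j] x := by
      intro j
      rw [hit]
      have := hord (j + cfQ α n) j (-cfP α n) 0 (by push_cast; nlinarith)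
      simpa using this
    have := dy_sum_le (cfQ α (n + 1))
      (fun j => f^[j + cfQ α n] x + ((-cfP α n - ⌊j * α⌋ : ℤ) : ℝ))
      (fun j => f^[j] x + ((-⌊j * α⌋ : ℤ) : ℝ))
      (f^[cfQ α n] x + ((-cfP α n : ℤ) : ℝ)) ?_ ?_ ?_ ?_
    · refine le_trans (le_of_eq ?_) this
      apply Finset.sum_congr rfl
      intro j _
      rw [abs_of_nonpos (by linarith [hb j]), hit]
      push_cast
      ring
    · intro j _
      apply hord
      push_cast
      linarith
    · intro j hj
      apply hord
      push_cast
      have := Int.floor_le (j * α)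
      linarith
    · intro j hj
      have := hord j (cfQ α n) (-⌊j * α⌋) (-cfP α n + 1) ?_
      · push_cast at this ⊢
        linarith
      · push_cast
        by_cases hj0 : j = 0
        · subst hj0
          have h1 := dy_D_abs_lt hα n
          rw [abs_of_neg hneg] at h1
          simp
          linarith
        · have h1 := hbest j 0 (⌊j * α⌋ + 1) hj0 hj (dy_Q_pos hα _)
          have h2 := Int.lt_floor_add_one (j * α)
          push_cast at h1
          rw [abs_of_neg hneg, abs_of_neg (by linarith)] at h1
          linarith
    · intro j hj k hk hjk
      have h1 := hbest j k (⌊j * α⌋ - ⌊k * α⌋) hjk hj hk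
      rw [abs_of_neg hneg, le_abs] at h1
      push_cast at h1
      rcases h1 with h1 | h1
      · right
        apply hord
        push_cast
        linarith
      · left
        apply hord
        push_cast
        linarith
  · have hb : ∀ j, f^[j] x ≤ cfIter f α n (f^[j] x) := by
      intro j
      rw [hit]
      have := hord j (j + cfQ α n) 0 (-cfP α n) (by push_cast; nlinarith)
      simpa using this
    have := dy_sum_le (cfQ α (n + 1))
      (fun j => f^[j] x + ((-⌊j * α⌋ : ℤ) : ℝ))
      (fun j => f^[j + cfQ α n] x + ((-cfP α n - ⌊j * α⌋ : ℤ) : ℝ))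
      x ?_ ?_ ?_ ?_
    · refine le_trans (le_of_eq ?_) this
      apply Finset.sum_congr rfl
      intro j _
      rw [abs_of_nonneg (by linarith [hb j]), hit]
      push_cast
      ring
    · intro j _
      apply hord
      push_cast
      linarith
    · intro j hj
      have := hord 0 j 0 (-⌊j * α⌋) (by push_cast; have := Int.floor_le (j * α); linarith)
      simpa using this
    · intro j hj
      have := hord (j + cfQ α n) 0 (-cfP α n - ⌊j * α⌋) 1 ?_
      · simpa using this
      · push_cast
        by_cases hj0 : j = 0
        · subst hj0
          have h1 := dy_D_abs_lt hα n
          rw [abs_of_pos hpos] at h1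
          simp
          linarith
        · have h1 := hbest j 0 (⌊j * α⌋ + 1) hj0 hj (dy_Q_pos hα _)
          have h2 := Int.lt_floor_add_one (j * α)
          push_cast at h1
          rw [abs_of_pos hpos, abs_of_neg (by linarith)] at h1
          linarith
    · intro j hj k hk hjk
      have h1 := hbest j k (⌊j * α⌋ - ⌊k * α⌋) hjk hj hk
      rw [abs_of_pos hpos, le_abs] at h1
      push_cast at h1
      rcases h1 with h1 | h1
      · right
        apply hord
        push_cast
        linarith
      · left
        apply hord
        push_cast
        linarith

lemma dy_gron (Δ : ℝ) (G : ℂ → ℂ) (hG : DifferentiableOn ℂ G {z : ℂ | |z.im| < Δ})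
    (hRe : ∀ z : ℂ, |z.im| < Δ → 0 < (deriv G z).re)
    (τ : ℝ) (hτsmall : τ < 1 / 9)
    (hτ : ∀ z : ℂ, |z.im| < Δ → ‖iteratedDeriv 2 G z / deriv G z‖ ≤ τ)
    (a b : ℂ) (ha : |a.im| < Δ) (hb : |b.im| < Δ) (K : ℝ) (hK : 0 < K)
    (hab : 1 / 9 * ‖b - a‖ ≤ K) :
    ‖deriv G b - deriv G a‖ ≤ ‖deriv G a‖ * (Real.exp K - 1) := by
  have hopen : IsOpen {z : ℂ | |z.im| < Δ} :=
    isOpen_lt (Complex.continuous_im.abs) continuous_const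
  have hG' : DifferentiableOn ℂ (deriv G) {z : ℂ | |z.im| < Δ} := hG.deriv hopen
  have hin : ∀ s ∈ Set.Icc (0 : ℝ) 1, |(a + s * (b - a)).im| < Δ := by
    intro s hs
    have : (a + s * (b - a)).im = (1 - s) * a.im + s * b.im := by
      simp
      ring
    rw [this]
    exact abs_lt.2 (convex_Ioo (-Δ) Δ (abs_lt.1 ha) (abs_lt.1 hb) (by linarith [hs.2]) hs.1 (by ring))
  have hd : ∀ s ∈ Set.Icc (0 : ℝ) 1, HasDerivAt (fun s : ℝ => deriv G (a + s * (b - a)) - deriv G a)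
      (deriv (deriv G) (a + s * (b - a)) * (b - a)) s := by
    intro s hs
    have h1 : HasDerivAt (deriv G) (deriv (deriv G) (a + s * (b - a))) (a + s * (b - a)) :=
      ((hG' _ (hin s hs)).differentiableAt (hopen.mem_nhds (hin s hs))).hasDerivAt
    have h2 : HasDerivAt (fun z : ℂ => a + z * (b - a)) (b - a) (s : ℂ) := by
      simpa using ((hasDerivAt_id (s : ℂ)).mul_const (b - a)).const_add a
    have h3 := (HasDerivAt.comp (s : ℂ) h1 h2).comp_ofReal
    exact h3.sub_const _
  have := norm_le_gronwallBound_of_norm_deriv_right_le (δ := 0) (K := K) (ε := K * ‖deriv G a‖)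
    (f := fun s : ℝ => deriv G (a + s * (b - a)) - deriv G a)
    (fun s hs => (hd s hs).continuousAt.continuousWithinAt)
    (fun s hs => (hd s ⟨hs.1, hs.2.le⟩).hasDerivWithinAt) (by simp) ?_ 1 (by simp)
  · rw [gronwallBound_of_K_ne_0 hK.ne'] at this
    simp only [Complex.ofReal_one, one_mul, add_sub_cancel, sub_zero, mul_one, zero_mul, zero_add]
      at this
    rwa [mul_div_cancel_left₀ _ hK.ne'] at this
  · intro s hs
    have hs' : s ∈ Set.Icc (0 : ℝ) 1 := ⟨hs.1, hs.2.le⟩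
    set z := a + s * (b - a) with hz
    have h1 := hτ z (hin s hs')
    have h2 := hRe z (hin s hs')
    have h3 : deriv G z ≠ 0 := by
      intro h
      rw [h] at h2
      simp at h2
    rw [iteratedDeriv_succ, iteratedDeriv_one, norm_div, div_le_iff₀ (norm_pos_iff.2 h3)] at h1
    rw [norm_mul]
    have h4 : ‖deriv G z‖ ≤ ‖deriv G z - deriv G a‖ + ‖deriv G a‖ := by
      simpa using norm_add_le (deriv G z - deriv G a) (deriv G a)
    calc ‖deriv (deriv G) z‖ * ‖b - a‖ ≤ (1 / 9 * ‖deriv G z‖) * ‖b - a‖ := by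
          gcongr
          nlinarith [norm_nonneg (deriv G z)]
      _ = (1 / 9 * ‖b - a‖) * ‖deriv G z‖ := by ring
      _ ≤ K * (‖deriv G z - deriv G a‖ + ‖deriv G a‖) := by gcongr
      _ = _ := by ring

lemma dy_step (Δ : ℝ) (hΔ : 0 < Δ) (g : ℝ → ℝ) (G : ℂ → ℂ)
    (hG : DifferentiableOn ℂ G {z : ℂ | |z.im| < Δ})
    (hGreal : ∀ x : ℝ, G (x : ℂ) = ((g x : ℝ) : ℂ))
    (hgmono : StrictMono g)
    (hRe : ∀ z : ℂ, |z.im| < Δ → 0 < (deriv G z).re)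
    (τ : ℝ) (hτsmall : τ < 1 / 9)
    (hτ : ∀ z : ℂ, |z.im| < Δ → ‖iteratedDeriv 2 G z / deriv G z‖ ≤ τ)
    (x m : ℝ) (hm : m ≠ 0) (hmΔ : |m| * (7 / 4) < Δ) (y : ℂ) (hy : ‖y‖ ≤ 7 / 4) :
    ∃ y' : ℂ, G (x + Complex.I * m * y) = (g x : ℂ) + Complex.I * ((g (x + m) - g x : ℝ) : ℂ) * y' ∧
      ‖y' - y‖ ≤ ‖y‖ * (Real.exp (11 / 36 * |m|) - 1) := by
  have hopen : IsOpen {z : ℂ | |z.im| < Δ} :=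
    isOpen_lt (Complex.continuous_im.abs) continuous_const
  set w : ℂ := Complex.I * m * y with hw
  have hwn : ‖w‖ = |m| * ‖y‖ := by simp [hw]
  have hm0 : 0 < |m| := abs_pos.2 hm
  set K : ℝ := 11 / 36 * |m| with hK
  have hKpos : 0 < K := by positivity
  have hexp : 0 < Real.exp K - 1 := by
    have := Real.add_one_lt_exp hKpos.ne'
    linarith
  -- membership
  have hinw : ∀ t ∈ Set.Icc (0 : ℝ) 1, |((x : ℂ) + t * w).im| < Δ := by
    intro t ht
    have h1 : ((x : ℂ) + t * w).im = t * w.im := by simp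
    rw [h1, abs_mul, abs_of_nonneg ht.1]
    have h2 := Complex.abs_im_le_norm w
    rw [hwn] at h2
    nlinarith [ht.1, ht.2, abs_nonneg w.im]
  have hinm : ∀ t : ℝ, |((x : ℂ) + t * m).im| < Δ := by
    intro t
    have h1 : ((x : ℂ) + t * m).im = 0 := by simp
    rw [h1, abs_zero]
    exact hΔ
  have hGd : ∀ z : ℂ, |z.im| < Δ → HasDerivAt G (deriv G z) z := fun z hz =>
    ((hG _ hz).differentiableAt (hopen.mem_nhds hz)).hasDerivAt
  have hdd : ∀ (c : ℂ) (t : ℝ), |((x : ℂ) + t * c).im| < Δ →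
      HasDerivAt (fun t : ℝ => G (x + t * c)) (deriv G (x + t * c) * c) t := by
    intro c t ht
    have h2 : HasDerivAt (fun z : ℂ => (x : ℂ) + z * c) c (t : ℂ) := by
      simpa using ((hasDerivAt_id (t : ℂ)).mul_const c).const_add (x : ℂ)
    exact (HasDerivAt.comp (t : ℂ) (hGd _ ht) h2).comp_ofReal
  -- derivative on the real line is real
  have hgd : ∀ t : ℝ, HasDerivAt (fun t : ℝ => g (x + t * m)) ((deriv G (x + t * m)).re * m) t := by
    intro t
    have h1 := hGd ((x + t * m : ℝ) : ℂ) (by push_cast; exact hinm t)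
    have h2 := h1.real_of_complex
    have h3 : (fun u : ℝ => (G u).re) = g := by
      funext u
      rw [hGreal, Complex.ofReal_re]
    rw [h3] at h2
    push_cast at h2
    have h4 : HasDerivAt (fun t : ℝ => x + t * m) m t := by
      simpa using ((hasDerivAt_id t).mul_const m).const_add x
    exact HasDerivAt.comp t h2 h4
  have hreal : ∀ t : ℝ, deriv G (x + t * m) = ((deriv G (x + t * m)).re : ℂ) := by
    intro t
    have h1 := (hgd t).ofReal_comp
    have h2 := hdd (m : ℂ) t (hinm t)
    have h3 : (fun t : ℝ => ((g (x + t * m) : ℝ) : ℂ)) = fun t : ℝ => G (x + t * m) := by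
      funext t
      rw [← hGreal]
      push_cast
      rfl
    rw [h3] at h1
    have h4 := h2.unique h1
    push_cast at h4
    exact mul_right_cancel₀ (by exact_mod_cast hm) h4
  set σ : ℝ := ((SignType.sign m : SignType) : ℝ) with hσ
  have hσm : σ * m = |m| := by rw [hσ]; exact sign_mul_self m
  have key := image_norm_le_of_norm_deriv_right_le_deriv_boundary
    (f := fun t : ℝ => (G (x + t * w) * m - G (x + t * m) * w) - (g x * m - g x * w))
    (f' := fun t : ℝ => deriv G (x + t * w) * w * m - deriv G (x + t * m) * m * w)
    (a := 0) (b := 1)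
    (B := fun t : ℝ => ‖w‖ * (Real.exp K - 1) * σ * (g (x + t * m) - g x))
    (B' := fun t : ℝ => ‖w‖ * (Real.exp K - 1) * σ * ((deriv G (x + t * m)).re * m))
    ?_ ?_ ?_ ?_ ?_ (x := 1) (by simp)
  · simp only [Complex.ofReal_one, one_mul] at key
    have hgx : G (x + m) = (g (x + m) : ℂ) := by
      rw [← hGreal]; push_cast; rfl
    rw [hgx] at key
    set m' : ℝ := g (x + m) - g x with hm'
    have hσm' : σ * m' = |m'| := by
      rcases lt_or_gt_of_ne hm with h | h
      · have : m' < 0 := by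
          have := hgmono (show x + m < x by linarith)
          linarith
        rw [hσ, sign_neg h, abs_of_neg this]
        simp
      · have : 0 < m' := by
          have := hgmono (show x < x + m by linarith)
          linarith
        rw [hσ, sign_pos h, abs_of_pos this]
        simp
    have hm'0 : m' ≠ 0 := by
      intro h
      have : g (x + m) = g x := by linarith
      have := hgmono.injective this
      exact hm (by linarith)
    have hm'c : (m' : ℂ) ≠ 0 := by exact_mod_cast hm'0
    refine ⟨(G (x + w) - g x) / (Complex.I * m'), ?_, ?_⟩
    · have hI := Complex.I_ne_zero
      field_simp
      ring
    · set y' : ℂ := (G (x + w) - g x) / (Complex.I * m') with hy'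
      have hyy : G (x + w) = g x + Complex.I * m' * y' := by
        have hI := Complex.I_ne_zero
        rw [hy']
        field_simp
        ring
      have h5 : (G (x + w) * m - (g (x + m) : ℂ) * w) - (g x * m - g x * w) =
          Complex.I * m * m' * (y' - y) := by
        rw [hyy, hm', hw]
        push_cast
        ring
      rw [h5, norm_mul, norm_mul, norm_mul, Complex.norm_I, Complex.norm_real, Complex.norm_real,
        hwn, one_mul, Real.norm_eq_abs, Real.norm_eq_abs] at key
      rw [mul_assoc _ σ m', hσm'] at key
      have hm'p : 0 < |m'| := abs_pos.2 hm'0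
      have : |m| * |m'| * ‖y' - y‖ ≤ |m| * |m'| * (‖y‖ * (Real.exp K - 1)) := by
        linarith
      exact le_of_mul_le_mul_left this (by positivity)
  · intro t ht
    exact (((((hdd w t (hinw t ht)).mul_const (m : ℂ)).sub
      ((hdd m t (hinm t)).mul_const w)).sub_const _).continuousAt).continuousWithinAt
  · intro t ht
    exact ((((hdd w t (hinw t ⟨ht.1, ht.2.le⟩)).mul_const (m : ℂ)).sub
      ((hdd m t (hinm t)).mul_const w)).sub_const _).hasDerivWithinAt
  · simp [hGreal]
  · intro t
    exact ((hgd t).sub_const _).const_mul _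
  · intro t ht
    have ht' : t ∈ Set.Icc (0 : ℝ) 1 := ⟨ht.1, ht.2.le⟩
    have h1 := dy_gron Δ G hG hRe τ hτsmall hτ _ _ (hinm t) (hinw t ht') K hKpos ?_
    · have h2 : deriv G (x + t * w) * w * m - deriv G (x + t * m) * m * w =
          w * m * (deriv G (x + t * w) - deriv G (x + t * m)) := by ring
      rw [h2, norm_mul, norm_mul, Complex.norm_real, Real.norm_eq_abs]
      have h3 : ‖deriv G (x + t * m)‖ = (deriv G (x + t * m)).re := by
        rw [hreal t, Complex.norm_real, Complex.ofReal_re, Real.norm_eq_abs,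
          abs_of_pos (hRe _ (hinm t))]
      rw [h3] at h1
      calc _ ≤ ‖w‖ * |m| * ((deriv G (x + t * m)).re * (Real.exp K - 1)) := by gcongr
        _ = _ := by rw [← hσm]; ring
    · have h2 : (x : ℂ) + t * w - (x + t * m) = t * m * (Complex.I * y - 1) := by
        rw [hw]; ring
      have h4 : ‖Complex.I * y - 1‖ ≤ 11 / 4 := by
        refine (norm_sub_le _ _).trans ?_
        rw [norm_mul, Complex.norm_I, norm_one]
        linarith
      rw [h2, norm_mul, norm_mul, Complex.norm_real, Complex.norm_real, Real.norm_eq_abs,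
        Real.norm_eq_abs, abs_of_nonneg ht.1]
      have h5 : t * |m| * ‖Complex.I * y - 1‖ ≤ 1 * |m| * (11 / 4) := by
        gcongr
        exact ht'.2
      rw [hK]
      linarith

/-- **Denjoy–Yoccoz Lemma.**
Let `g ∈ D^ω(𝕋,Δ)` (real-analytic circle diffeomorphism lift with holomorphic extension `G`
to the strip `B_Δ`), with `Re G′ > 0` on `B_Δ`, irrational rotation number `α`, and
nonlinearity `τ = sup_{B_Δ} |(log g′)′| < 1/9`.  Let `n` be such that `Mₙ < Δ/2`, `x₀ ∈ ℝ`,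
`0 < y₀ ≤ 1` and `z₀ = x₀ + i mₙ(x₀) y₀`.  Then for `0 ≤ j ≤ q_{n+1}` the iterate `G^j(z₀)`
lies in `B_Δ`, and writing `G^j(z₀) = g^j(x₀) + i mₙ(g^j(x₀)) y_j` one has `Re y_j > 0` and
`|y_j − y₀| ≤ (3/4) y₀`. -/
theorem denjoy_yoccoz
    (Δ : ℝ) (hΔ : 0 < Δ)
    (g : ℝ → ℝ) (G : ℂ → ℂ) (V : Set ℂ)
    (hVopen : IsOpen V) (hVΔ : closure {z : ℂ | |z.im| < Δ} ⊆ V)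
    (hVshift : ∀ z : ℂ, z ∈ V ↔ z + 1 ∈ V)
    (hGholo : DifferentiableOn ℂ G V) (hGinj : Set.InjOn G V)
    (hGonto : closure {z : ℂ | |z.im| < Δ} ⊆ G '' V)
    (hGreal : ∀ x : ℝ, G (x : ℂ) = ((g x : ℝ) : ℂ))
    (hgmono : StrictMono g) (hgsurj : Function.Surjective g)
    (hgper : ∀ x : ℝ, g (x + 1) = g x + 1)
    (hGper : ∀ z ∈ V, G (z + 1) = G z + 1)
    (hRe : ∀ z : ℂ, |z.im| < Δ → 0 < (deriv G z).re)
    (α : ℝ) (hα : Irrational α)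
    (hrot : ∀ x : ℝ, Tendsto (fun m : ℕ => (g^[m] x - x) / m) atTop (𝓝 α))
    (τ : ℝ) (hτsmall : τ < 1 / 9)
    (hτ : ∀ z : ℂ, |z.im| < Δ → ‖iteratedDeriv 2 G z / deriv G z‖ ≤ τ)
    (n : ℕ) (hMn : (⨆ x : ℝ, |cfIter g α n x - x|) < Δ / 2)
    (x₀ y₀ : ℝ) (hy₀ : 0 < y₀) (hy₀1 : y₀ ≤ 1)
    (z₀ : ℂ) (hz₀ : z₀ = (x₀ : ℂ) + Complex.I * ((cfIter g α n x₀ - x₀ : ℝ) : ℂ) * (y₀ : ℂ)) :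
    ∀ j ≤ cfQ α (n + 1),
      |(G^[j] z₀).im| < Δ ∧
      ∃ yj : ℂ,
        G^[j] z₀ = ((g^[j] x₀ : ℝ) : ℂ) +
          Complex.I * ((cfIter g α n (g^[j] x₀) - g^[j] x₀ : ℝ) : ℂ) * yj ∧
        0 < yj.re ∧ ‖yj - ((y₀ : ℝ) : ℂ)‖ ≤ (3 / 4) * y₀ := by
  have hsub : {z : ℂ | |z.im| < Δ} ⊆ V := subset_closure.trans hVΔ
  have hG : DifferentiableOn ℂ G {z : ℂ | |z.im| < Δ} := hGholo.mono hsub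
  let f : CircleDeg1Lift := ⟨⟨g, hgmono.monotone⟩, hgper⟩
  have hfg : (f : ℝ → ℝ) = g := rfl
  have hfα : f.translationNumber = α := by
    have h1 := f.tendsto_translationNumber 0
    have h2 := hrot 0
    simp only [CircleDeg1Lift.coe_pow, hfg] at h1
    exact tendsto_nhds_unique h1 h2
  have hsum := dy_sum f (by rw [hfα]; exact hα) x₀ n
  rw [hfα, hfg] at hsum
  have hbdd : BddAbove (Set.range fun x : ℝ => |cfIter g α n x - x|) := by
    refine ⟨|(f ^ cfQ α n) 0| + 1 + |(cfP α n : ℝ)|, ?_⟩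
    rintro _ ⟨x, rfl⟩
    have h1 := (f ^ cfQ α n).map_le_of_map_zero x
    have h2 := (f ^ cfQ α n).le_map_of_map_zero x
    have h3 := Int.ceil_lt_add_one x
    have h4 := Int.lt_floor_add_one x
    have h5 : cfIter g α n x = (f ^ cfQ α n) x - cfP α n := by
      rw [CircleDeg1Lift.coe_pow]; rfl
    simp only [h5]
    have h6 := abs_le.1 (le_refl |(f ^ cfQ α n) 0|)
    have h7 := abs_le.1 (le_refl |(cfP α n : ℝ)|)
    rw [abs_le]
    constructor <;> linarith [h6.1, h6.2, h7.1, h7.2]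
  have hmΔ : ∀ x, |cfIter g α n x - x| < Δ / 2 := fun x =>
    lt_of_le_of_lt (le_ciSup hbdd x) hMn
  have hm0 : ∀ x, cfIter g α n x - x ≠ 0 := by
    intro x h
    have h1 : (f ^ cfQ α n) x = x + cfP α n := by
      rw [CircleDeg1Lift.coe_pow]
      unfold cfIter at h
      rw [hfg]
      linarith
    have h2 := CircleDeg1Lift.translationNumber_of_eq_add_int _ h1
    rw [f.translationNumber_pow, hfα] at h2
    exact (hα.natCast_mul (dy_Q_pos hα n).ne').ne_int _ h2
  have hcomm : ∀ x, g (cfIter g α n x) = cfIter g α n (g x) := by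
    intro x
    unfold cfIter
    rw [← hfg, f.map_sub_int, ← Function.iterate_succ_apply' f, Function.iterate_succ_apply]
  have hexp : Real.exp (11 / 36) ≤ 7 / 4 := by
    have h1 : Real.exp (11 / 36 : ℝ) ≤ 1 / (1 - 11 / 36) := by
      have := Real.one_sub_le_exp_neg (11 / 36 : ℝ)
      rw [Real.exp_neg] at this
      rw [one_div]
      exact (le_inv_comm₀ (by norm_num) (Real.exp_pos _)).1 this
    refine h1.trans ?_
    norm_num
  set S : ℕ → ℝ := fun j => ∑ i ∈ Finset.range j, |cfIter g α n (g^[i] x₀) - g^[i] x₀| with hS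
  have hS1 : ∀ j ≤ cfQ α (n + 1), S j ≤ 1 := by
    intro j hj
    refine le_trans ?_ hsum
    apply Finset.sum_le_sum_of_subset_of_nonneg
    · exact Finset.range_mono hj
    · intro i _ _
      exact abs_nonneg _
  have hbound : ∀ j ≤ cfQ α (n + 1), y₀ * (Real.exp (11 / 36 * S j) - 1) ≤ 3 / 4 * y₀ := by
    intro j hj
    have h1 : Real.exp (11 / 36 * S j) ≤ Real.exp (11 / 36) :=
      Real.exp_le_exp.2 (by linarith [hS1 j hj])
    nlinarith
  have hmain : ∀ j ≤ cfQ α (n + 1), ∃ yj : ℂ,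
      G^[j] z₀ = ((g^[j] x₀ : ℝ) : ℂ) +
          Complex.I * ((cfIter g α n (g^[j] x₀) - g^[j] x₀ : ℝ) : ℂ) * yj ∧
      ‖yj - ((y₀ : ℝ) : ℂ)‖ ≤ y₀ * (Real.exp (11 / 36 * S j) - 1) := by
    intro j
    induction j with
    | zero =>
      intro _
      refine ⟨y₀, by simpa using hz₀, by simp [hS]⟩
    | succ j ih =>
      intro hj
      obtain ⟨y, hy1, hy2⟩ := ih (by omega)
      have hb := hbound j (by omega)
      have hyn : ‖y‖ ≤ ‖y - (y₀ : ℂ)‖ + y₀ := by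
        have := norm_add_le (y - (y₀ : ℂ)) y₀
        rw [sub_add_cancel, Complex.norm_real, Real.norm_eq_abs, abs_of_pos hy₀] at this
        exact this
      set x := g^[j] x₀ with hx
      set m := cfIter g α n x - x with hm
      obtain ⟨y', hy'1, hy'2⟩ := dy_step Δ hΔ g G hG hGreal hgmono hRe τ hτsmall hτ x m (hm0 x)
        (by have := hmΔ x; rw [← hm] at this; linarith) y (by linarith)
      refine ⟨y', ?_, ?_⟩
      · rw [Function.iterate_succ_apply', Function.iterate_succ_apply', hy1, ← hx, hy'1, ← hcomm]
        rw [show x + m = cfIter g α n x by rw [hm]; ring]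
      · have hSs : S (j + 1) = S j + |m| := by
          simp only [hS, Finset.sum_range_succ]
          rfl
        rw [hSs, mul_add, Real.exp_add]
        have h1 : ‖y' - (y₀ : ℂ)‖ ≤ ‖y' - y‖ + ‖y - (y₀ : ℂ)‖ := by
          simpa using norm_add_le (y' - y) (y - (y₀ : ℂ))
        have h2 : 1 ≤ Real.exp (11 / 36 * |m|) := Real.one_le_exp (by positivity)
        have h3 : ‖y‖ ≤ y₀ * Real.exp (11 / 36 * S j) := by linarith
        nlinarith
  intro j hj
  obtain ⟨y, hy1, hy2⟩ := hmain j hj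
  have hb := hy2.trans (hbound j hj)
  have hre := (Complex.abs_re_le_norm (y - (y₀ : ℂ))).trans hb
  rw [Complex.sub_re, Complex.ofReal_re, abs_le] at hre
  refine ⟨?_, y, hy1, by linarith [hre.1], hb⟩
  have him : (G^[j] z₀).im = (cfIter g α n (g^[j] x₀) - g^[j] x₀) * y.re := by
    rw [hy1]
    simp
  have hyp : 0 < y.re := by linarith [hre.1]
  rw [him, abs_mul, abs_of_pos hyp]
  have h1 := hmΔ (g^[j] x₀)
  have h2 := abs_nonneg (cfIter g α n (g^[j] x₀) - g^[j] x₀)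
  nlinarith [hre.2]
end

section
/- Fix y₀ with 1/2 < y₀ ≤ 1. There exist a constant C > 0 and n₀ ≥ 1 such that for all n ≥ n₀ and all x₀ ∈ ℝ, the arc Ĩₙ(x₀) = {x + i·|mₙ(x)|·y₀ : x ∈ Iₙ(x₀)} ⊂ ℍ has hyperbolic diameter at most C, where the hyperbolic diameter is taken with respect to the Poincaré distance d_P of the upper half-plane ℍ = {z ∈ ℂ : Im z > 0}. (Note that mₙ(x) ≠ 0 for all x since α is irrational and g is analytic.) -/
open Filter Topology

/-- The point `x + i |mₙ(x)| y₀` of the flow curve at height `y₀` over `x`. -/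
noncomputable def liftPt (g : ℝ → ℝ) (α : ℝ) (n : ℕ) (y₀ x : ℝ) : ℂ :=
  (x : ℂ) + Complex.I * ((|cfIter g α n x - x| : ℝ) : ℂ) * ((y₀ : ℝ) : ℂ)

theorem cfGauss_irr (α : ℝ) (hα : Irrational α) (n : ℕ) : Irrational (cfGauss α n) := by
  induction n with
  | zero => exact hα
  | succ k ih =>
    have : Irrational (Int.fract (cfGauss α k)) := by
      unfold Int.fract
      exact ih.sub_intCast _
    exact this.inv

theorem cfGauss_gt (α : ℝ) (hα : Irrational α) (n : ℕ) : 1 < cfGauss α (n + 1) := by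
  have hirr := cfGauss_irr α hα n
  have h0 : 0 < Int.fract (cfGauss α n) := by
    rcases (Int.fract_nonneg (cfGauss α n)).lt_or_eq with h | h
    · exact h
    · exfalso
      have h2 : (⌊cfGauss α n⌋ : ℝ) = cfGauss α n := by
        have := Int.floor_add_fract (cfGauss α n)
        linarith
      exact hirr ⟨⌊cfGauss α n⌋, by exact_mod_cast h2⟩
  exact (one_lt_inv₀ h0).2 (Int.fract_lt_one _)

theorem cfA_pos (α : ℝ) (hα : Irrational α) (n : ℕ) : 1 ≤ cfA α (n + 1) := by
  unfold cfA
  exact Int.le_floor.2 (by exact_mod_cast (cfGauss_gt α hα n).le)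

theorem cfGauss_rel (α : ℝ) (hα : Irrational α) (n : ℕ) :
    cfGauss α (n + 1) * cfGauss α n = cfGauss α (n + 1) * cfA α n + 1 := by
  have h1 := cfGauss_gt α hα n
  have h2 : cfGauss α (n + 1) * Int.fract (cfGauss α n) = 1 := by
    have h3 : cfGauss α (n + 1) = (Int.fract (cfGauss α n))⁻¹ := rfl
    have h4 : Int.fract (cfGauss α n) ≠ 0 := by
      intro h; rw [h] at h3; rw [h3] at h1; norm_num at h1
    rw [h3]; exact inv_mul_cancel₀ h4
  have h5 := Int.floor_add_fract (cfGauss α n)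
  unfold cfA
  linear_combination h2 - cfGauss α (n + 1) * h5

theorem cf_facts (α : ℝ) (hα : Irrational α) (n : ℕ) :
    0 < cfQ α n ∧ 0 < cfQ α (n + 1) ∧
    α * (cfGauss α (n + 2) * cfQ α (n + 1) + cfQ α n)
      = cfGauss α (n + 2) * cfP α (n + 1) + cfP α n ∧
    (cfP α (n + 1) * cfQ α n - cfP α n * cfQ α (n + 1) = 1 ∨
      cfP α (n + 1) * cfQ α n - cfP α n * cfQ α (n + 1) = -1) := by
  induction n with
  | zero =>
    have h1 := cfA_pos α hα 0
    have hc : ((cfA α 1).toNat : ℤ) = cfA α 1 := Int.toNat_of_nonneg (by linarith)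
    have hcR : ((cfA α 1).toNat : ℝ) = cfA α 1 := by exact_mod_cast hc
    have r0 := cfGauss_rel α hα 0
    have r1 := cfGauss_rel α hα 1
    have e0 : cfGauss α 0 = α := rfl
    have g1 := cfGauss_gt α hα 0
    simp only [zero_add] at *
    rw [e0] at r0
    refine ⟨by simp [cfQ], by simp only [cfQ]; omega, ?_, ?_⟩
    · simp only [cfQ, cfP, hcR]
      push_cast
      have : cfGauss α 1 ≠ 0 := by linarith
      apply mul_left_cancel₀ this
      linear_combination (cfGauss α 2 * cfA α 1 + 1) * r0 - r1
    · left
      simp only [cfQ, cfP, hc]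
      push_cast
      ring
  | succ k ih =>
    obtain ⟨i1, i2, i3, i4⟩ := ih
    have h1 := cfA_pos α hα (k + 1)
    have hc : ((cfA α (k + 2)).toNat : ℤ) = cfA α (k + 2) := Int.toNat_of_nonneg (by
      show 0 ≤ cfA α (k + 1 + 1); linarith)
    have hcR : ((cfA α (k + 2)).toNat : ℝ) = cfA α (k + 2) := by exact_mod_cast hc
    have r := cfGauss_rel α hα (k + 2)
    have g1 := cfGauss_gt α hα (k + 1)
    have eP : cfP α (k + 2) = cfA α (k + 2) * cfP α (k + 1) + cfP α k := by simp only [cfP]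
    have eQ : cfQ α (k + 2) = (cfA α (k + 2)).toNat * cfQ α (k + 1) + cfQ α k := by
      simp only [cfQ]
    refine ⟨i2, ?_, ?_, ?_⟩
    · show 0 < cfQ α (k + 2)
      rw [eQ]; positivity
    · show α * (cfGauss α (k + 3) * cfQ α (k + 2) + cfQ α (k + 1))
        = cfGauss α (k + 3) * cfP α (k + 2) + cfP α (k + 1)
      rw [eP, eQ]
      push_cast
      rw [hcR]
      linear_combination cfGauss α (k + 3) * i3 - (α * cfQ α (k + 1) - cfP α (k + 1)) * r
    · show cfP α (k + 2) * cfQ α (k + 1) - cfP α (k + 1) * cfQ α (k + 2) = 1 ∨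
        cfP α (k + 2) * cfQ α (k + 1) - cfP α (k + 1) * cfQ α (k + 2) = -1
      rw [eP, eQ]
      push_cast
      rw [hc]
      rcases i4 with i4 | i4
      · right; linear_combination -i4
      · left; linear_combination -i4

theorem cf_main (α : ℝ) (hα : Irrational α) (n : ℕ) (hn : 1 ≤ n) :
    0 < cfQ α n ∧ (∃ u v : ℤ, u * cfP α n + v * cfQ α n = 1) ∧
      |α - cfP α n / cfQ α n| ≤ 1 / (cfQ α n : ℝ) ^ 2 := by
  obtain ⟨k, rfl⟩ : ∃ k, n = k + 1 := ⟨n - 1, by omega⟩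
  obtain ⟨i1, i2, i3, i4⟩ := cf_facts α hα k
  have hg := cfGauss_gt α hα (k + 1)
  refine ⟨i2, ?_, ?_⟩
  · rcases i4 with i4 | i4
    · exact ⟨cfQ α k, -cfP α k, by linarith⟩
    · exact ⟨-cfQ α k, cfP α k, by linarith⟩
  · have hq : (0 : ℝ) < cfQ α (k + 1) := by exact_mod_cast i2
    have hq' : (0 : ℝ) < cfQ α k := by exact_mod_cast i1
    set D := cfGauss α (k + 2) * cfQ α (k + 1) + cfQ α k with hD
    have hg' : 1 < cfGauss α (k + 2) := hg
    have hDge : (cfQ α (k + 1) : ℝ) ≤ D := by nlinarith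
    have hDpos : 0 < D := by linarith
    have hab : |((cfP α (k + 1) * cfQ α k - cfP α k * cfQ α (k + 1) : ℤ) : ℝ)| = 1 := by
      rcases i4 with i4 | i4 <;> rw [i4] <;> norm_num
    have e : α - cfP α (k + 1) / cfQ α (k + 1) =
        -((cfP α (k + 1) * cfQ α k - cfP α k * cfQ α (k + 1) : ℤ) : ℝ)
          / (D * cfQ α (k + 1)) := by
      field_simp
      push_cast
      linear_combination (cfQ α (k + 1) : ℝ) * i3 - (cfP α (k + 1) : ℝ) * hD
    rw [e, abs_div, abs_neg, hab, abs_of_pos (by positivity)]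
    apply one_div_le_one_div_of_le (by positivity)
    nlinarith

theorem iter_add_int (g : ℝ → ℝ) (hper : ∀ x (m : ℤ), g (x + m) = g x + m) (j : ℕ) :
    ∀ x (m : ℤ), g^[j] (x + m) = g^[j] x + m := by
  induction j with
  | zero => intro x m; rfl
  | succ k ih => intro x m; rw [Function.iterate_succ_apply, Function.iterate_succ_apply, hper, ih]

theorem add_int_of_add_one (g : ℝ → ℝ) (hper : ∀ x, g (x + 1) = g x + 1) :
    ∀ x (m : ℤ), g (x + m) = g x + m := by
  intro x m
  induction m using Int.induction_on generalizing x with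
  | zero => simp
  | succ i ih =>
    have := hper (x + (i : ℤ))
    push_cast at *
    rw [← add_assoc, this, ih]; ring
  | pred i ih =>
    have := hper (x + ((-(i : ℤ) - 1 : ℤ) : ℝ))
    have h2 := ih x
    have e : x + ((-(i : ℤ) - 1 : ℤ) : ℝ) + 1 = x + ((-(i : ℤ) : ℤ) : ℝ) := by push_cast; ring
    rw [e, h2] at this
    push_cast at *
    linarith

/-- reindexed orbit -/
noncomputable def orbX (g : ℝ → ℝ) (q : ℕ) (p u : ℤ) (x : ℝ) (k : ℤ) : ℝ :=
  g^[((u * k) % q).toNat] x + (((k - ((u * k) % q) * p) / q : ℤ) : ℝ)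

theorem orb_dvd (q : ℕ) (p u v : ℤ) (huv : u * p + v * q = 1) (k : ℤ) :
    (q : ℤ) ∣ (k - ((u * k) % q) * p) := by
  have h := Int.emod_add_mul_ediv (u * k) q
  refine ⟨v * k + (u * k / q) * p, ?_⟩
  linear_combination (-k) * huv - p * h

theorem orbX_h (g h : ℝ → ℝ) (α : ℝ) (hg : ∀ x, h (g x) = h x + α)
    (h1 : ∀ x (m : ℤ), h (x + m) = h x + m) (q : ℕ) (hq : 0 < q) (p u v : ℤ)
    (huv : u * p + v * q = 1) (happ : |α - p / q| ≤ 1 / (q : ℝ) ^ 2) (x : ℝ) (k : ℤ) :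
    h x + (k - 1) / q < h (orbX g q p u x k) ∧ h (orbX g q p u x k) < h x + (k + 1) / q := by
  have hqR : (0 : ℝ) < q := by exact_mod_cast hq
  have hit : ∀ j : ℕ, h (g^[j] x) = h x + j * α := by
    intro j
    induction j with
    | zero => simp
    | succ i ih => rw [Function.iterate_succ_apply', hg, ih]; push_cast; ring
  unfold orbX
  rw [h1, hit]
  obtain ⟨c, hc⟩ := orb_dvd q p u v huv k
  set j := (u * k) % q with hj
  have hj0 : 0 ≤ j := Int.emod_nonneg _ (by omega)
  have hjq : j < q := Int.emod_lt_of_pos _ (by omega)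
  have hjt : (j.toNat : ℤ) = j := Int.toNat_of_nonneg hj0
  have hjt' : (j.toNat : ℝ) = (j : ℝ) := by exact_mod_cast hjt
  rw [hc, Int.mul_ediv_cancel_left _ (by omega), hjt']
  have hcR : (k : ℝ) - j * p = q * c := by exact_mod_cast hc
  have hj0R : (0 : ℝ) ≤ j := by exact_mod_cast hj0
  have hjqR : (j : ℝ) < q := by exact_mod_cast hjq
  have hce : (c : ℝ) = k / q - j * (p / q) := by field_simp; linarith
  have key : |(j : ℝ) * (α - p / q)| < 1 / q := by
    rw [abs_mul, abs_of_nonneg hj0R]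
    calc (j : ℝ) * |α - p / q| ≤ j * (1 / (q : ℝ) ^ 2) := by gcongr
      _ < q * (1 / (q : ℝ) ^ 2) := by gcongr
      _ = 1 / q := by field_simp
  rw [abs_lt] at key
  rw [hce, sub_div, add_div]
  constructor <;> linarith [key.1, key.2]

theorem orbX_period (g : ℝ → ℝ) (q : ℕ) (hq : 0 < q) (p u : ℤ) (x : ℝ) (k : ℤ) :
    orbX g q p u x (k + q) = orbX g q p u x k + 1 := by
  unfold orbX
  have e1 : u * (k + q) % q = u * k % q := by
    rw [mul_add, Int.add_mul_emod_self_right]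
  rw [e1]
  have e2 : (k + q - u * k % q * p) / q = (k - u * k % q * p) / q + 1 := by
    have : (k + q - u * k % q * p) = (k - u * k % q * p) + 1 * q := by ring
    rw [this, Int.add_mul_ediv_right _ _ (by omega)]
  rw [e2]; push_cast; ring

theorem orbX_sum (g φ : ℝ → ℝ) (hφ : ∀ x (m : ℤ), φ (x + m) = φ x) (q : ℕ) (hq : 0 < q)
    (p u v : ℤ) (huv : u * p + v * q = 1) (x : ℝ) (i : ℤ) :
    ∑ k ∈ Finset.range q, φ (orbX g q p u x (i + k)) = ∑ j ∈ Finset.range q, φ (g^[j] x) := by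
  have maps : ∀ k ∈ Finset.range q, ((u * (i + k)) % q).toNat ∈ Finset.range q := by
    intro k _
    have h0 : 0 ≤ (u * (i + k)) % q := Int.emod_nonneg _ (by omega)
    have h1 : (u * (i + k)) % q < q := Int.emod_lt_of_pos _ (by omega)
    rw [Finset.mem_range]; omega
  have inj : Set.InjOn (fun k : ℕ => ((u * (i + k)) % q).toNat) (Finset.range q : Finset ℕ) := by
    intro a ha b hb hab
    simp only [Finset.coe_range, Set.mem_Iio] at ha hb
    simp only at hab
    have h0 : 0 ≤ (u * (i + a)) % q := Int.emod_nonneg _ (by omega)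
    have h1 : 0 ≤ (u * (i + b)) % q := Int.emod_nonneg _ (by omega)
    have hab' : (u * (i + a)) % q = (u * (i + b)) % q := by omega
    have hd : (q : ℤ) ∣ u * (i + a) - u * (i + b) := Int.ModEq.dvd (Eq.symm hab')
    have hd2 : (q : ℤ) ∣ (a : ℤ) - b := by
      obtain ⟨c, hc⟩ := hd
      refine ⟨p * c + v * (a - b), ?_⟩
      linear_combination (-(a - b : ℤ)) * huv + p * hc
    have := Int.eq_zero_of_abs_lt_dvd hd2 (by rw [abs_lt]; constructor <;> omega)
    omega
  refine Finset.sum_nbij (fun k : ℕ => ((u * (i + k)) % q).toNat) maps inj ?_ ?_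
  · exact Finset.surjOn_of_injOn_of_card_le _ maps inj le_rfl
  · intro k _
    unfold orbX
    rw [hφ]

theorem koksma (g h φ : ℝ → ℝ) (α L : ℝ) (hL : 0 ≤ L) (hm : Monotone h)
    (hg : ∀ x, h (g x) = h x + α)
    (h1 : ∀ x (m : ℤ), h (x + m) = h x + m) (hφ : ∀ x (m : ℤ), φ (x + m) = φ x)
    (hLip : ∀ x y, |φ x - φ y| ≤ L * |x - y|) (q : ℕ) (hq : 0 < q) (p u v : ℤ)
    (huv : u * p + v * q = 1) (happ : |α - p / q| ≤ 1 / (q : ℝ) ^ 2) (x z : ℝ) :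
    |∑ j ∈ Finset.range q, φ (g^[j] x) - ∑ j ∈ Finset.range q, φ (g^[j] z)| ≤ 5 * L := by
  have hqR : (0 : ℝ) < q := by exact_mod_cast hq
  set i : ℤ := ⌊q * (h z - h x)⌋ with hi
  have hi1 : (i : ℝ) / q ≤ h z - h x := by
    rw [div_le_iff₀ hqR, mul_comm]; exact Int.floor_le _
  have hi2 : h z - h x < (i + 1) / q := by
    rw [lt_div_iff₀ hqR, mul_comm]; exact Int.lt_floor_add_one _
  rw [← orbX_sum g φ hφ q hq p u v huv x i, ← orbX_sum g φ hφ q hq p u v huv z 0,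
    ← Finset.sum_sub_distrib]
  set X := orbX g q p u x with hX
  have hXh := orbX_h g h α hg h1 q hq p u v huv happ x
  have hZh := orbX_h g h α hg h1 q hq p u v huv happ z
  have lt_of : ∀ {a b}, h a < h b → a < b := fun {a b} hab => hm.reflect_lt hab
  have hX2 : ∀ k l : ℤ, k + 2 ≤ l → X k < X l := by
    intro k l hkl
    apply lt_of
    have a := (hXh k).2
    have b := (hXh l).1
    have : ((k : ℝ) + 1) / q ≤ (l - 1) / q := by
      gcongr
      have : ((k + 2 : ℤ) : ℝ) ≤ l := by exact_mod_cast hkl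
      push_cast at this; linarith
    linarith
  have tele : ∀ c : ℤ, ∑ k ∈ Finset.range q, (X (c + 1 + k) - X (c + k)) = 1 := by
    intro c
    have := Finset.sum_range_sub (fun k : ℕ => X (c + k)) q
    have e : ∀ k : ℕ, X (c + 1 + k) = X (c + ((k + 1 : ℕ) : ℤ)) := by
      intro k; congr 1; push_cast; ring
    simp only [e]
    rw [this, hX, orbX_period g q hq]
    simp
  have tele5 : ∑ k ∈ Finset.range q, (X (i + 3 + k) - X (i - 2 + k)) = 5 := by
    have t1 := tele (i - 2)
    have t2 := tele (i - 1)
    have t3 := tele i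
    have t4 := tele (i + 1)
    have t5 := tele (i + 2)
    have e1 : i - 2 + 1 = i - 1 := by ring
    have e2 : i - 1 + 1 = i := by ring
    have e3 : i + 1 + 1 = i + 2 := by ring
    have e4 : i + 2 + 1 = i + 3 := by ring
    rw [e1] at t1; rw [e2] at t2; rw [e3] at t4; rw [e4] at t5
    rw [Finset.sum_sub_distrib] at *
    linarith
  calc |∑ k ∈ Finset.range q, (φ (X (i + k)) - φ (orbX g q p u z (0 + k)))|
      ≤ ∑ k ∈ Finset.range q, |φ (X (i + k)) - φ (orbX g q p u z (0 + k))| :=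
        Finset.abs_sum_le_sum_abs _ _
    _ ≤ ∑ k ∈ Finset.range q, L * (X (i + 3 + k) - X (i - 2 + k)) := by
        apply Finset.sum_le_sum
        intro k _
        refine (hLip _ _).trans (mul_le_mul_of_nonneg_left ?_ hL)
        have a1 : X (i - 2 + k) < X (i + k) := hX2 _ _ (by omega)
        have a2 : X (i + k) < X (i + 3 + k) := hX2 _ _ (by omega)
        have a3 : X (i - 2 + k) < orbX g q p u z (0 + k) := by
          apply lt_of
          have a := (hXh (i - 2 + k)).2
          have b := (hZh (0 + k)).1
          push_cast at a b
          have : ((i : ℝ) - 2 + k + 1) / q = i / q + (0 + k - 1) / q := by ring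
          linarith
        have a4 : orbX g q p u z (0 + k) < X (i + 3 + k) := by
          apply lt_of
          have a := (hXh (i + 3 + k)).1
          have b := (hZh (0 + k)).2
          push_cast at a b
          have : ((i : ℝ) + 3 + k - 1) / q = (i + 1) / q + (0 + k + 1) / q := by ring
          linarith
        rw [abs_le]; constructor <;> linarith
    _ = 5 * L := by rw [← Finset.mul_sum, tele5]; ring

theorem exists_semiconj (g : ℝ → ℝ) (hgmono : StrictMono g) (hgsurj : Function.Surjective g)
    (hgper : ∀ x : ℝ, g (x + 1) = g x + 1) (α : ℝ)
    (hrot : ∀ x : ℝ, Tendsto (fun m : ℕ => (g^[m] x - x) / m) atTop (𝓝 α)) :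
    ∃ h : ℝ → ℝ, Monotone h ∧ (∀ x, h (g x) = h x + α) ∧
      ∀ x (m : ℤ), h (x + m) = h x + m := by
  let f : CircleDeg1Lift := ⟨⟨g, hgmono.monotone⟩, hgper⟩
  have hf : ⇑f = g := rfl
  have hτ : f.translationNumber = α := by
    apply f.translationNumber_eq_of_tendsto₀
    simpa [hf] using hrot 0
  let t : CircleDeg1Lift := (CircleDeg1Lift.translate (Multiplicative.ofAdd α) : CircleDeg1Liftˣ)
  have ht : t.translationNumber = α := CircleDeg1Lift.translationNumber_translate α
  obtain ⟨F, hF⟩ := CircleDeg1Lift.semiconj_of_bijective_of_translationNumber_eq (f₁ := f) (f₂ := t)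
    ⟨hgmono.injective, hgsurj⟩ (CircleDeg1Lift.isUnit_iff_bijective.1 (Units.isUnit _))
    (hτ.trans ht.symm)
  refine ⟨F, F.monotone, ?_, fun x m => F.map_add_int x m⟩
  intro x
  have := hF x
  rw [hf] at this
  rw [this]
  exact add_comm _ _

theorem lip_log (g : ℝ → ℝ) (hganal : ∀ x : ℝ, AnalyticAt ℝ g x)
    (hgder : ∀ x : ℝ, 0 < deriv g x)
    (hgper : ∀ x : ℝ, g (x + 1) = g x + 1) :
    (∀ x (m : ℤ), Real.log (deriv g (x + m)) = Real.log (deriv g x)) ∧ ∃ L : ℝ, 0 ≤ L ∧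
      ∀ x y, |Real.log (deriv g x) - Real.log (deriv g y)| ≤ L * |x - y| := by
  have hint := add_int_of_add_one g hgper
  have hdper : ∀ x (m : ℤ), deriv g (x + m) = deriv g x := by
    intro x m
    rw [← deriv_comp_add_const]
    have : (fun x => g (x + m)) = fun x => g x + m := funext fun x => hint x m
    rw [this, deriv_add_const]
  refine ⟨fun x m => by rw [hdper], ?_⟩
  have hd : ∀ x, AnalyticAt ℝ (fun x => Real.log (deriv g x)) x := fun x =>
    ((hganal x).deriv).log (hgder x)
  have hc : Continuous (deriv (fun x => Real.log (deriv g x))) :=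
    continuous_iff_continuousAt.2 fun x => (hd x).deriv.continuousAt
  have hp : Function.Periodic (deriv (fun x => Real.log (deriv g x))) 1 := by
    intro x
    rw [← deriv_comp_add_const]
    congr 1
    funext y
    have := hdper y 1
    push_cast at this
    rw [this]
  obtain ⟨L, hL⟩ := (hp.isBounded_of_continuous one_ne_zero hc).exists_norm_le
  refine ⟨max L 0, le_max_right _ _, fun x y => ?_⟩
  have := Convex.norm_image_sub_le_of_norm_deriv_le (s := Set.univ)
    (f := fun x => Real.log (deriv g x)) (C := max L 0) (x := y) (y := x)
    (fun x _ => (hd x).differentiableAt)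
    (fun x _ => (hL _ ⟨x, rfl⟩).trans (le_max_left _ _)) convex_univ trivial trivial
  simpa [Real.norm_eq_abs] using this

theorem iter_deriv (g : ℝ → ℝ) (hganal : ∀ x : ℝ, AnalyticAt ℝ g x)
    (hgder : ∀ x : ℝ, 0 < deriv g x) (q : ℕ) : ∀ x, ∃ d, HasDerivAt g^[q] d x ∧ 0 < d ∧
      Real.log d = ∑ j ∈ Finset.range q, Real.log (deriv g (g^[j] x)) := by
  induction q with
  | zero => intro x; exact ⟨1, hasDerivAt_id x, one_pos, by simp⟩
  | succ k ih =>
    intro x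
    obtain ⟨d, h1, h2, h3⟩ := ih x
    refine ⟨deriv g (g^[k] x) * d, ?_, mul_pos (hgder _) h2, ?_⟩
    · rw [Function.iterate_succ']
      exact HasDerivAt.comp x (hganal _).differentiableAt.hasDerivAt h1
    · rw [Real.log_mul (hgder _).ne' h2.ne', Finset.sum_range_succ, h3, add_comm]

theorem denjoy (g : ℝ → ℝ) (hganal : ∀ x : ℝ, AnalyticAt ℝ g x)
    (hgmono : StrictMono g) (hgsurj : Function.Surjective g)
    (hgder : ∀ x : ℝ, 0 < deriv g x)
    (hgper : ∀ x : ℝ, g (x + 1) = g x + 1)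
    (α : ℝ) (hα : Irrational α)
    (hrot : ∀ x : ℝ, Tendsto (fun m : ℕ => (g^[m] x - x) / m) atTop (𝓝 α)) :
    ∃ M : ℝ, 1 ≤ M ∧ ∀ n ≥ 1, (∀ x, cfIter g α n x ≠ x) ∧ ∀ a b, a ≤ b →
      (cfIter g α n b - cfIter g α n a ≤ M * (b - a) ∧
      b - a ≤ M * (cfIter g α n b - cfIter g α n a)) := by
  obtain ⟨h, hm, hg, h1⟩ := exists_semiconj g hgmono hgsurj hgper α hrot
  obtain ⟨hφ, L, hL0, hL⟩ := lip_log g hganal hgder hgper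
  refine ⟨Real.exp (5 * L), Real.one_le_exp (by positivity), fun n hn => ?_⟩
  obtain ⟨hq, ⟨u, v, huv⟩, happ⟩ := cf_main α hα n hn
  have hint := add_int_of_add_one g hgper
  have hD : ∀ x, ∃ d, HasDerivAt g^[cfQ α n] d x ∧ d ≤ Real.exp (5 * L) ∧
      Real.exp (-(5 * L)) ≤ d := by
    have hdiff : ∀ x, DifferentiableAt ℝ g^[cfQ α n] x := fun x =>
      (iter_deriv g hganal hgder (cfQ α n) x).choose_spec.1.differentiableAt
    obtain ⟨z, -, hz⟩ := exists_deriv_eq_slope g^[cfQ α n] (zero_lt_one' ℝ)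
      (fun x _ => (hdiff x).continuousAt.continuousWithinAt)
      (fun x _ => (hdiff x).differentiableWithinAt)
    have e := iter_add_int g hint (cfQ α n) 0 1
    norm_num at e
    rw [e] at hz
    norm_num at hz
    obtain ⟨dz, hz1, hz2, hz3⟩ := iter_deriv g hganal hgder (cfQ α n) z
    rw [hz1.deriv] at hz
    rw [hz, Real.log_one] at hz3
    intro x
    obtain ⟨d, hx1, hx2, hx3⟩ := iter_deriv g hganal hgder (cfQ α n) x
    have key := koksma g h (fun x => Real.log (deriv g x)) α L hL0 hm hg h1 hφ hL
      (cfQ α n) hq (cfP α n) u v huv happ x z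
    rw [← hx3, ← hz3, sub_zero, abs_le] at key
    exact ⟨d, hx1, (Real.log_le_iff_le_exp hx2).1 key.2, (Real.le_log_iff_exp_le hx2).1 key.1⟩
  constructor
  · intro x hx
    have hit : ∀ j : ℕ, h (g^[j] x) = h x + j * α := by
      intro j
      induction j with
      | zero => simp
      | succ i ih => rw [Function.iterate_succ_apply', hg, ih]; push_cast; ring
    unfold cfIter at hx
    have e : g^[cfQ α n] x = x + cfP α n := by linarith
    have := hit (cfQ α n)
    rw [e, h1] at this
    have e2 : (cfQ α n : ℝ) * α = cfP α n := by linarith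
    exact (hα.natCast_mul hq.ne').ne_int _ e2
  · intro a b hab
    unfold cfIter
    rcases hab.eq_or_lt with rfl | hab
    · simp
    choose d hd1 hd2 hd3 using hD
    obtain ⟨c, -, hc⟩ := exists_hasDerivAt_eq_slope g^[cfQ α n] d hab
      (fun x _ => (hd1 x).continuousAt.continuousWithinAt) (fun x _ => hd1 x)
    have hba : 0 < b - a := by linarith
    have e : g^[cfQ α n] b - cfP α n - (g^[cfQ α n] a - cfP α n) = d c * (b - a) := by
      rw [hc]; field_simp; ring
    rw [e]
    refine ⟨mul_le_mul_of_nonneg_right (hd2 c) hba.le, ?_⟩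
    have : 1 ≤ Real.exp (5 * L) * d c := by
      calc (1 : ℝ) = Real.exp (5 * L) * Real.exp (-(5 * L)) := by
            rw [← Real.exp_add]; simp
        _ ≤ _ := mul_le_mul_of_nonneg_left (hd3 c) (Real.exp_pos _).le
    nlinarith

theorem comparable (T : ℝ → ℝ) (M : ℝ) (hM : 1 ≤ M)
    (hT : ∀ a b, a ≤ b → (T b - T a ≤ M * (b - a) ∧ b - a ≤ M * (T b - T a)))
    (x₀ x : ℝ) (hx : x ∈ Set.uIcc x₀ (T x₀)) :
    |T x - x| ≤ (M + 1) * |T x₀ - x₀| ∧ |T x₀ - x₀| ≤ M * |T x - x| := by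
  rcases le_total x₀ (T x₀) with h | h
  · rw [Set.uIcc_of_le h] at hx
    obtain ⟨a, b⟩ := hx
    obtain ⟨c, d⟩ := hT _ _ a
    have e : 0 ≤ T x - T x₀ := by nlinarith
    rw [abs_of_nonneg (by linarith), abs_of_nonneg (by linarith)]
    constructor <;> nlinarith
  · rw [Set.uIcc_of_ge h] at hx
    obtain ⟨a, b⟩ := hx
    obtain ⟨c, d⟩ := hT _ _ b
    have e : 0 ≤ T x₀ - T x := by nlinarith
    rw [abs_of_nonpos (by linarith), abs_of_nonpos (by linarith)]
    constructor <;> nlinarith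

/-- **Bounded hyperbolic diameter of the arcs `Ĩₙ(x₀)`.**
Let `g` be the lift of a real-analytic orientation-preserving circle diffeomorphism with
irrational rotation number `α`, and fix `1/2 < y₀ ≤ 1`.  There are `C > 0` and `n₀ ≥ 1` such
that for all `n ≥ n₀` and `x₀ ∈ ℝ`, the arc `Ĩₙ(x₀) = {x + i |mₙ(x)| y₀ : x ∈ Iₙ(x₀)} ⊆ ℍ`
has hyperbolic diameter at most `C`. -/
theorem arcs_bounded_hyperbolic_diameter
    (g : ℝ → ℝ) (hganal : ∀ x : ℝ, AnalyticAt ℝ g x)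
    (hgmono : StrictMono g) (hgsurj : Function.Surjective g)
    (hgder : ∀ x : ℝ, 0 < deriv g x)
    (hgper : ∀ x : ℝ, g (x + 1) = g x + 1)
    (α : ℝ) (hα : Irrational α)
    (hrot : ∀ x : ℝ, Tendsto (fun m : ℕ => (g^[m] x - x) / m) atTop (𝓝 α))
    (y₀ : ℝ) (hy₀ : 1 / 2 < y₀) (hy₀1 : y₀ ≤ 1) :
    ∃ C > (0 : ℝ), ∃ n₀ : ℕ, 1 ≤ n₀ ∧ ∀ n ≥ n₀, ∀ x₀ : ℝ,
      ∀ x ∈ Set.uIcc x₀ (cfIter g α n x₀), ∀ x' ∈ Set.uIcc x₀ (cfIter g α n x₀),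
        ∃ (h : 0 < (liftPt g α n y₀ x).im) (h' : 0 < (liftPt g α n y₀ x').im),
          dist (⟨liftPt g α n y₀ x, h⟩ : UpperHalfPlane)
            (⟨liftPt g α n y₀ x', h'⟩ : UpperHalfPlane) ≤ C := by
  obtain ⟨M, hM, H⟩ := denjoy g hganal hgmono hgsurj hgder hgper α hα hrot
  refine ⟨1 + (1 + 2 * (M + 1) ^ 2) * (2 * M ^ 2), by positivity, 1, le_rfl, ?_⟩
  intro n hn x₀ x hx x' hx'
  obtain ⟨hne, hT⟩ := H n hn
  have im_eq : ∀ x, (liftPt g α n y₀ x).im = |cfIter g α n x - x| * y₀ := by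
    intro x
    unfold liftPt
    rw [mul_assoc, ← Complex.ofReal_mul]
    simp
  have re_eq : ∀ x, (liftPt g α n y₀ x).re = x := by
    intro x
    unfold liftPt
    rw [mul_assoc, ← Complex.ofReal_mul]
    simp
  have hpos : ∀ x, 0 < |cfIter g α n x - x| := fun x => abs_pos.2 (sub_ne_zero.2 (hne x))
  have hp : ∀ x, 0 < (liftPt g α n y₀ x).im := fun x => by
    rw [im_eq]; exact mul_pos (hpos x) (by linarith)
  refine ⟨hp x, hp x', ?_⟩
  set z : UpperHalfPlane := ⟨liftPt g α n y₀ x, hp x⟩ with hz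
  set w : UpperHalfPlane := ⟨liftPt g α n y₀ x', hp x'⟩ with hw
  have zr : z.re = x := re_eq x
  have wr : w.re = x' := re_eq x'
  have zi : z.im = |cfIter g α n x - x| * y₀ := im_eq x
  have wi : w.im = |cfIter g α n x' - x'| * y₀ := im_eq x'
  have c1 : dist z w ≤ Real.cosh (dist z w) :=
    (Real.self_le_sinh_iff.2 dist_nonneg).trans (Real.sinh_lt_cosh _).le
  refine c1.trans ?_
  rw [UpperHalfPlane.cosh_dist', zr, wr, zi, wi]
  obtain ⟨a1, a2⟩ := comparable _ M hM hT x₀ x hx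
  obtain ⟨b1, b2⟩ := comparable _ M hM hT x₀ x' hx'
  have hxx : |x - x'| ≤ |cfIter g α n x₀ - x₀| := by
    have := Set.abs_sub_le_of_uIcc_subset_uIcc (Set.uIcc_subset_uIcc hx' hx)
    simpa using this
  have hm0 := hpos x₀
  have ha := hpos x
  have hb := hpos x'
  set m₀ := |cfIter g α n x₀ - x₀|
  set a := |cfIter g α n x - x|
  set b := |cfIter g α n x' - x'|
  have hy : 0 < y₀ := by linarith
  have hM0 : 0 < M := by linarith
  rw [div_le_iff₀ (by positivity)]
  have s1 : (x - x') ^ 2 ≤ m₀ ^ 2 := sq_le_sq' (by linarith [(abs_le.1 hxx).1]) (abs_le.1 hxx).2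
  have s2 : (a * y₀) ^ 2 ≤ ((M + 1) * m₀) ^ 2 := by
    apply pow_le_pow_left₀ (by positivity); nlinarith
  have s3 : (b * y₀) ^ 2 ≤ ((M + 1) * m₀) ^ 2 := by
    apply pow_le_pow_left₀ (by positivity); nlinarith
  have s4 : m₀ ^ 2 ≤ M ^ 2 * (a * b) := by
    calc m₀ ^ 2 = m₀ * m₀ := sq _
      _ ≤ (M * a) * (M * b) := mul_le_mul a2 b2 hm0.le (by positivity)
      _ = _ := by ring
  have s5 : a * b ≤ 4 * ((a * y₀) * (b * y₀)) := by
    have : 1 ≤ 4 * y₀ ^ 2 := by nlinarith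
    have hab : 0 < a * b := by positivity
    nlinarith
  have s6 : m₀ ^ 2 ≤ 4 * M ^ 2 * ((a * y₀) * (b * y₀)) := by
    have := mul_le_mul_of_nonneg_left s5 (sq_nonneg M)
    linarith
  have s7 := mul_le_mul_of_nonneg_left s6 (show 0 ≤ 1 + 2 * (M + 1) ^ 2 by positivity)
  have s8 : 0 < (a * y₀) * (b * y₀) := by positivity
  calc _ ≤ (1 + 2 * (M + 1) ^ 2) * m₀ ^ 2 := by linarith
    _ ≤ _ := s7
    _ ≤ _ := by linarith
end
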